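/- Under the batch-removal regularized-empirical-risk model, suppose s ↦ ℓ''(s,y) is γ₂-Lipschitz for every label y, and there is a constant F > 0 with ‖z_i'‖ ≤ F for all i ∈ {1,…,n}. Let Z' ∈ ℝ^{n×d} be the matrix whose i-th row is (z_i')ᵀ, and let ‖Z'‖ denote its operator norm. Then the gradient residual of the unlearned model satisfies the data-dependent bound ‖∇_w L(w', D')‖ ≤ γ₂ F · ‖Z'‖ · ‖H⁻¹Δ‖ · ‖Z' H⁻¹Δ‖. -/

import Mathlib

open scoped InnerProductSpace BigOperators

/-- A function whose derivative is `K`-Lipschitz differs from its first-order Taylor polynomial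
by at most `K` times the square of the increment. -/
lemma abs_sub_sub_mul_le_of_lipschitz_deriv {f f' : ℝ → ℝ} {K : ℝ} (hK : 0 ≤ K)
    (hf : ∀ s, HasDerivAt f (f' s) s) (hf' : ∀ s t, |f' s - f' t| ≤ K * |s - t|) (a b : ℝ) :
    |f (a + b) - f a - f' a * b| ≤ K * b ^ 2 := by
  have hderiv : ∀ s ∈ Set.uIcc a (a + b),
      HasDerivWithinAt (fun t => f t - f' a * t) (f' s - f' a) (Set.uIcc a (a + b)) s := by
    intro s _
    have h := (hf s).sub ((hasDerivAt_id s).const_mul (f' a))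
    simp only [mul_one] at h
    exact h.hasDerivWithinAt
  have hbound : ∀ s ∈ Set.uIcc a (a + b), ‖f' s - f' a‖ ≤ K * |b| := by
    intro s hs
    have h := Set.abs_sub_left_of_mem_uIcc hs
    rw [add_sub_cancel_left] at h
    exact (hf' s a).trans (mul_le_mul_of_nonneg_left h hK)
  have h := (convex_uIcc a (a + b)).norm_image_sub_le_of_norm_hasDerivWithin_le hderiv hbound
    Set.left_mem_uIcc Set.right_mem_uIcc
  rw [Real.norm_eq_abs, Real.norm_eq_abs, add_sub_cancel_left] at h
  calc |f (a + b) - f a - f' a * b| = |f (a + b) - f' a * (a + b) - (f a - f' a * a)| := by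
        congr 1; ring
    _ ≤ K * |b| * |b| := h
    _ = K * b ^ 2 := by rw [mul_assoc, abs_mul_abs_self, sq]

/-- First-order optimality condition for a regularized empirical risk. -/
lemma sum_smul_add_smul_eq_zero_of_minimizer {E ι : Type*} [NormedAddCommGroup E]
    [InnerProductSpace ℝ E] [Fintype ι] {f f' : ι → ℝ → ℝ}
    (hf : ∀ i s, HasDerivAt (f i) (f' i s) s) (z : ι → E) (c : ℝ) (w : E)
    (hw : ∀ v : E, (∑ i, f i ⟪w, z i⟫_ℝ) + c / 2 * ‖w‖ ^ 2 ≤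
      (∑ i, f i ⟪v, z i⟫_ℝ) + c / 2 * ‖v‖ ^ 2) :
    (∑ i, f' i ⟪w, z i⟫_ℝ • z i) + c • w = 0 := by
  refine ext_inner_left ℝ fun v => ?_
  have hline : HasDerivAt (fun t : ℝ => w + t • v) v 0 := by
    simpa using ((hasDerivAt_id (0 : ℝ)).smul_const v).const_add w
  have hloss : ∀ i, HasDerivAt (fun t : ℝ => f i ⟪w + t • v, z i⟫_ℝ)
      (f' i ⟪w, z i⟫_ℝ * ⟪v, z i⟫_ℝ) 0 := by
    intro i
    have hinner : HasDerivAt (fun t : ℝ => ⟪w + t • v, z i⟫_ℝ) ⟪v, z i⟫_ℝ 0 := by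
      simpa using hline.inner ℝ (hasDerivAt_const (0 : ℝ) (z i))
    exact HasDerivAt.comp (0 : ℝ) (by simpa using hf i ⟪w, z i⟫_ℝ) hinner
  have hrisk := (HasDerivAt.fun_sum fun i (_ : i ∈ Finset.univ) => hloss i).add
    (hline.norm_sq.const_mul (c / 2))
  have hmin : IsLocalMin ((fun t : ℝ => ∑ i, f i ⟪w + t • v, z i⟫_ℝ) +
      fun t : ℝ => c / 2 * ‖w + t • v‖ ^ 2) 0 :=
    Filter.Eventually.of_forall fun t => by simpa using hw (w + t • v)
  have h := hmin.hasDerivAt_eq_zero hrisk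
  simp only [zero_smul, add_zero] at h
  rw [inner_zero_right, inner_add_right, inner_sum, inner_smul_right, ← h, real_inner_comm v w]
  simp only [inner_smul_right]
  ring

/-- A nonnegative combination of rank-one matrices plus a positive multiple of the identity is
positive definite. -/
lemma posDef_sum_smul_vecMulVec_add_smul_one {ι κ : Type*} [Fintype ι] [Fintype κ]
    [DecidableEq κ] {a : ι → ℝ} (ha : ∀ i, 0 ≤ a i) (x : ι → κ → ℝ) {c : ℝ} (hc : 0 < c) :
    ((∑ i, a i • Matrix.vecMulVec (x i) (x i)) + c • (1 : Matrix κ κ ℝ)).PosDef := by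
  refine Matrix.PosDef.posSemidef_add ?_ (Matrix.PosDef.one.smul hc)
  refine Matrix.posSemidef_sum _ fun i _ => Matrix.PosSemidef.smul ?_ (ha i)
  simpa using Matrix.posSemidef_vecMulVec_self_star (x i)

/-- If the coordinates of `A v` are the inner products of `v` with `x i`, then the combination
`∑ i, r i • x i`, which is the adjoint of `A` applied to `r`, has norm at most `‖A‖ * ‖r‖`. -/
lemma norm_sum_smul_le_of_apply_eq_inner {E ι : Type*} [NormedAddCommGroup E]
    [InnerProductSpace ℝ E] [Fintype ι] (A : E →L[ℝ] EuclideanSpace ℝ ι) (x : ι → E)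
    (hA : ∀ v i, A v i = ⟪v, x i⟫_ℝ) (r : EuclideanSpace ℝ ι) :
    ‖∑ i, r i • x i‖ ≤ ‖A‖ * ‖r‖ := by
  set v := ∑ i, r i • x i with hv
  have hinner : ⟪v, v⟫_ℝ = ⟪A v, r⟫_ℝ := by
    conv_lhs => rw [hv, inner_sum, ← hv]
    simp [PiLp.inner_apply, hA, inner_smul_right]
  have hsq : ‖v‖ * ‖v‖ ≤ ‖A‖ * ‖r‖ * ‖v‖ := by
    rw [← real_inner_self_eq_norm_mul_norm, hinner]
    calc ⟪A v, r⟫_ℝ ≤ ‖A v‖ * ‖r‖ := real_inner_le_norm _ _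
      _ ≤ ‖A‖ * ‖v‖ * ‖r‖ := by gcongr; exact A.le_opNorm v
      _ = ‖A‖ * ‖r‖ * ‖v‖ := by ring
  rcases (norm_nonneg v).eq_or_lt with h | h
  · rw [← h]; positivity
  · exact le_of_mul_le_mul_right hsq h

/-- A coordinatewise bound by a multiple of another vector bounds the Euclidean norm. -/
lemma EuclideanSpace.norm_le_mul_norm_of_abs_le {ι : Type*} [Fintype ι]
    {r b : EuclideanSpace ℝ ι} {C : ℝ} (hC : 0 ≤ C) (h : ∀ i, |r i| ≤ C * |b i|) :
    ‖r‖ ≤ C * ‖b‖ := by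
  refine le_of_sq_le_sq ?_ (by positivity)
  rw [mul_pow, EuclideanSpace.real_norm_sq_eq, EuclideanSpace.real_norm_sq_eq, Finset.mul_sum]
  refine Finset.sum_le_sum fun i _ => ?_
  rw [← sq_abs (r i), ← sq_abs (b i), ← mul_pow]
  exact pow_le_pow_left₀ (abs_nonneg _) (h i) 2

/-- Theorem 4 / data-dependent bound.
Under the batch-removal regularized-empirical-risk model, if `s ↦ ℓ''(s,y)` is
`γ₂`-Lipschitz and `‖z' i‖ ≤ F` for all `i`, then the gradient residual of the unlearned
model satisfies the data-dependent bound
`‖∇L(w', D')‖ ≤ γ₂ F ‖Z'‖ ‖H⁻¹Δ‖ ‖Z' H⁻¹Δ‖`, where `Z'` is the matrix whose `i`-th row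
is `(z' i)ᵀ` and `‖Z'‖` is its operator norm. -/
theorem gradient_residual_data_dependent
    (d n : ℕ) (hn : 1 ≤ n) (lam : ℝ) (hlam : 0 < lam)
    -- the loss `ℓ`, twice continuously differentiable in its first argument,
    -- with first and second partial derivatives `dl` and `ddl`
    (ℓ dl ddl : ℝ → ℝ → ℝ)
    (hdl : ∀ (yy s : ℝ), HasDerivAt (fun t => ℓ t yy) (dl s yy) s)
    (hddl : ∀ (yy s : ℝ), HasDerivAt (fun t => dl t yy) (ddl s yy) s)
    (hddl_cont : ∀ yy : ℝ, Continuous fun s => ddl s yy)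
    (hddl_nonneg : ∀ s yy : ℝ, 0 ≤ ddl s yy)
    -- the dataset `D = ((z i, y i))_i` and the updated dataset `D'`, obtained by
    -- replacing the embeddings `z i` by `z' i` for `i` in the removal set `S`
    (z : Fin n → EuclideanSpace ℝ (Fin d)) (y : Fin n → ℝ)
    (S : Finset (Fin n))
    (z' : Fin n → EuclideanSpace ℝ (Fin d)) (hz' : ∀ i ∉ S, z' i = z i)
    -- `wstar` minimizes the regularized empirical risk `L(·, D)`
    (wstar : EuclideanSpace ℝ (Fin d))
    (hwstar : ∀ w : EuclideanSpace ℝ (Fin d),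
      (∑ i, ℓ ⟪wstar, z i⟫_ℝ (y i)) + lam * n / 2 * ‖wstar‖ ^ 2 ≤
        (∑ i, ℓ ⟪w, z i⟫_ℝ (y i)) + lam * n / 2 * ‖w‖ ^ 2)
    -- the assumptions of the theorem: `s ↦ ℓ''(s, y)` is `γ₂`-Lipschitz and the
    -- updated embeddings are bounded in norm by `F`
    (γ2 F : ℝ) (hγ2pos : 0 < γ2) (hF : 0 < F)
    (hγ2 : ∀ (yy s t : ℝ), |ddl s yy - ddl t yy| ≤ γ2 * |s - t|)
    (hz'F : ∀ i, ‖z' i‖ ≤ F)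
    -- the matrix `Z'` whose `i`-th row is `(z' i)ᵀ`, viewed as an operator
    -- `ℝ^d → ℝ^n` (its norm below is the operator norm)
    (Zmat : Matrix (Fin n) (Fin d) ℝ) (hZmat : ∀ i, Zmat i = z' i)
    (Zop : EuclideanSpace ℝ (Fin d) →L[ℝ] EuclideanSpace ℝ (Fin n))
    (hZop : Zop = LinearMap.toContinuousLinearMap (Matrix.toEuclideanLin Zmat))
    -- the Hessian `H = ∇²L(wstar, D')`, the gradient difference `Δ`, and the
    -- unlearned model `w' = wstar + H⁻¹ Δ`
    (H : Matrix (Fin d) (Fin d) ℝ)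
    (hH : H = (∑ i, ddl ⟪wstar, z' i⟫_ℝ (y i) • Matrix.vecMulVec (z' i) (z' i)) +
      (lam * n) • (1 : Matrix (Fin d) (Fin d) ℝ))
    (Δ : EuclideanSpace ℝ (Fin d))
    (hΔ : Δ = ∑ i, (dl ⟪wstar, z i⟫_ℝ (y i) • z i - dl ⟪wstar, z' i⟫_ℝ (y i) • z' i))
    (u : EuclideanSpace ℝ (Fin d)) (hu : u = Matrix.toEuclideanLin H⁻¹ Δ)
    (w' : EuclideanSpace ℝ (Fin d)) (hw' : w' = wstar + u) :
    -- conclusion: data-dependent bound on the gradient residual `‖∇L(w', D')‖`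
    ‖(∑ i, dl ⟪w', z' i⟫_ℝ (y i) • z' i) + (lam * n) • w'‖ ≤
      γ2 * F * ‖Zop‖ * ‖u‖ * ‖Zop u‖ := by
  have hn' : (0 : ℝ) < n := by exact_mod_cast hn
  have hZu : ∀ v i, Zop v i = ⟪v, z' i⟫_ℝ := by
    intro v i
    rw [hZop]
    simp [Matrix.toLpLin_apply, Matrix.mulVec, hZmat, dotProduct, PiLp.inner_apply]
  have hopt := sum_smul_add_smul_eq_zero_of_minimizer (fun i => hdl (y i)) z (lam * n) wstar hwstar
  have hunit : IsUnit H.det := by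
    rw [hH]
    exact (posDef_sum_smul_vecMulVec_add_smul_one (fun i => hddl_nonneg _ _) _
      (mul_pos hlam hn')).det_pos.ne'.isUnit
  have hnewton : (∑ i, (ddl ⟪wstar, z' i⟫_ℝ (y i) * ⟪u, z' i⟫_ℝ) • z' i) + (lam * n) • u = Δ := by
    have hHu : H.mulVec u = Δ := by
      rw [hu, Matrix.toLpLin_apply, Matrix.mulVec_mulVec, Matrix.mul_nonsing_inv _ hunit,
        Matrix.one_mulVec]
    ext k
    rw [← hHu, hH, Matrix.add_mulVec, Matrix.sum_mulVec]
    simp only [Matrix.smul_mulVec, Matrix.vecMulVec_mulVec, Matrix.one_mulVec]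
    simp [PiLp.inner_apply, dotProduct, mul_comm, mul_left_comm]
  set r : EuclideanSpace ℝ (Fin n) := WithLp.toLp 2 fun i =>
    dl (⟪wstar, z' i⟫_ℝ + ⟪u, z' i⟫_ℝ) (y i) - dl ⟪wstar, z' i⟫_ℝ (y i) -
      ddl ⟪wstar, z' i⟫_ℝ (y i) * ⟪u, z' i⟫_ℝ with hr
  have hgrad : (∑ i, dl ⟪w', z' i⟫_ℝ (y i) • z' i) + (lam * n) • w' = ∑ i, r i • z' i := by
    rw [Finset.sum_sub_distrib, eq_neg_of_add_eq_zero_left hopt] at hΔ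
    rw [hΔ] at hnewton
    simp only [hr, hw', inner_add_left, sub_smul, Finset.sum_sub_distrib, smul_add]
    rw [eq_sub_of_add_eq hnewton]
    abel
  have hres : ‖r‖ ≤ γ2 * F * ‖u‖ * ‖Zop u‖ := by
    refine EuclideanSpace.norm_le_mul_norm_of_abs_le (by positivity) fun i => ?_
    rw [hZu]
    have hb : |⟪u, z' i⟫_ℝ| ≤ F * ‖u‖ :=
      (abs_real_inner_le_norm _ _).trans (by rw [mul_comm]; gcongr; exact hz'F i)
    calc |r i| ≤ γ2 * ⟪u, z' i⟫_ℝ ^ 2 :=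
          abs_sub_sub_mul_le_of_lipschitz_deriv hγ2pos.le (hddl (y i)) (hγ2 (y i)) _ _
      _ = γ2 * |⟪u, z' i⟫_ℝ| * |⟪u, z' i⟫_ℝ| := by rw [mul_assoc, abs_mul_abs_self, sq]
      _ ≤ γ2 * (F * ‖u‖) * |⟪u, z' i⟫_ℝ| := by gcongr
      _ = γ2 * F * ‖u‖ * |⟪u, z' i⟫_ℝ| := by ring
  rw [hgrad]
  calc ‖∑ i, r i • z' i‖ ≤ ‖Zop‖ * ‖r‖ := norm_sum_smul_le_of_apply_eq_inner Zop z' hZu r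
    _ ≤ ‖Zop‖ * (γ2 * F * ‖u‖ * ‖Zop u‖) := by gcongr
    _ = γ2 * F * ‖Zop‖ * ‖u‖ * ‖Zop u‖ := by ring
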